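/- arXiv:0710.0574 — 2 statements merged into one kernel-verified Lean document; each statement's English description precedes it below -/
import Mathlib

section
/- For the k×k circulant matrix M_k = circ(1+q−N₁, −q, 0, ..., 0, −1) over ℤ[q, N₁] (k ≥ 3, with M₁ = [−N₁] and M₂ = [[1+q−N₁, −1−q],[−1−q, 1+q−N₁]]), the substitution N₁ ↦ −t yields det(M_k)|_{N₁=−t} = 𝒲_k(q,t), the spanning-tree polynomial of the (q,t)-wheel graph. -/
/-- The `k×k` circulant matrix `M_k = circ(1+q−N₁, −q, 0, …, 0, −1)` (for `k ≥ 3`). -/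
def Mcirc (q N₁ : ℤ) (k : ℕ) [NeZero k] : Matrix (ZMod k) (ZMod k) ℤ :=
  Matrix.of fun i j =>
    if j = i then 1 + q - N₁ else if j = i + 1 then -q else if j = i - 1 then -1 else 0

/-- The weighted spanning-tree polynomial `𝒲_k(q,t)` of the wheel graph `W_k`,
encoded as in the previous statement: `f v = 0` means rim vertex `v` uses its
spoke, `f v = 1` means it uses the clockwise rim edge, `f v = 2` the
counterclockwise one; weight `q^(dist T) · t^(#spokes T)`. -/
def wheelTreeSum (q t : ℤ) (k : ℕ) [NeZero k] : ℤ :=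
  ∑ f ∈ (Finset.univ : Finset (ZMod k → Fin 3)).filter
      (fun f => (∃ v, f v = 0) ∧ ∀ v, ¬(f v = 1 ∧ f (v + 1) = 2)),
    q ^ (Finset.univ.filter (fun v => f v = 1)).card *
      t ^ (Finset.univ.filter (fun v => f v = 0)).card

/-- Weight of a choice. -/
def chW (q t : ℤ) (c : Fin 3) : ℤ := (if c = 1 then q else 1) * (if c = 0 then t else 1)

/-- Row of the matrix `P_f`: the target of the choice `c` at `v`. -/
def chP (k : ℕ) (v : ZMod k) (c : Fin 3) : ZMod k → ℤ :=
  if c = 0 then 0 else if c = 1 then Pi.single (v + 1) 1 else Pi.single (v - 1) 1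

/-- The matrix `P_f`. -/
def chM (k : ℕ) (f : ZMod k → Fin 3) : Matrix (ZMod k) (ZMod k) ℤ :=
  Matrix.of fun v => chP k v (f v)

lemma prod_chW (q t : ℤ) (k : ℕ) [NeZero k] (f : ZMod k → Fin 3) :
    ∏ v, chW q t (f v) = q ^ (Finset.univ.filter (fun v => f v = 1)).card *
      t ^ (Finset.univ.filter (fun v => f v = 0)).card := by
  simp only [chW, Finset.prod_mul_distrib]
  simp [Finset.prod_ite]

lemma row_eq (q t : ℤ) (k : ℕ) [NeZero k] (hk : 3 ≤ k) :
    Mcirc q (-t) k = fun v => ∑ c : Fin 3, chW q t c • (Pi.single v 1 - chP k v c) := by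
  have h1 : (1 : ZMod k) ≠ 0 := by
    have : Fact (1 < k) := ⟨by omega⟩
    exact one_ne_zero
  have h2 : (2 : ZMod k) ≠ 0 := by
    intro h
    have h' : ((2 : ℕ) : ZMod k) = 0 := by exact_mod_cast h
    rw [ZMod.natCast_eq_zero_iff] at h'
    have := Nat.le_of_dvd (by norm_num) h'
    omega
  funext v j
  have a1 : v ≠ v + 1 := by simpa using h1
  have a2 : v ≠ v - 1 := by
    intro h; apply h1; linear_combination h
  have a3 : v + 1 ≠ v - 1 := by
    intro h; apply h2; linear_combination h
  simp only [Mcirc, Matrix.of_apply, Fin.sum_univ_three, Pi.add_apply, Pi.smul_apply,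
    Pi.sub_apply, chW, chP, Pi.single_apply, smul_eq_mul]
  by_cases e1 : j = v
  · subst e1
    simp [a1, a2, Pi.single_apply]; ring
  · by_cases e2 : j = v + 1
    · subst e2
      simp [a3, h1, Pi.single_apply]
    · by_cases e3 : j = v - 1
      · subst e3
        simp [a2.symm, a3.symm, h1, Pi.single_apply]
      · simp [e1, e2, e3, Pi.single_apply]

lemma det_expand (q t : ℤ) (k : ℕ) [NeZero k] (hk : 3 ≤ k) :
    (Mcirc q (-t) k).det = ∑ f : ZMod k → Fin 3,
      (∏ v, chW q t (f v)) * (1 - chM k f).det := by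
  rw [row_eq q t k hk]
  have h := (Matrix.detRowAlternating (n := ZMod k) (R := ℤ)).toMultilinearMap.map_sum
    (fun (v : ZMod k) (c : Fin 3) => chW q t c • (Pi.single v 1 - chP k v c : ZMod k → ℤ))
  refine Eq.trans h (Finset.sum_congr rfl fun f _ => ?_)
  have h' := (Matrix.detRowAlternating (n := ZMod k) (R := ℤ)).toMultilinearMap.map_smul_univ
    (fun v => chW q t (f v)) (fun v => (Pi.single v 1 - chP k v (f v) : ZMod k → ℤ))
  refine h'.trans ?_
  rw [smul_eq_mul]
  congr 1
  change Matrix.det _ = _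
  congr 1
  ext i j
  simp [chM, Matrix.one_apply, Pi.single_apply, eq_comm]

lemma chM_mulVec (k : ℕ) [NeZero k] (f : ZMod k → Fin 3) (x : ZMod k → ℤ) (v : ZMod k) :
    (chM k f).mulVec x v =
      if f v = 0 then 0 else if f v = 1 then x (v + 1) else x (v - 1) := by
  simp only [chM, Matrix.mulVec, Matrix.of_apply, chP]
  split_ifs <;> simp

lemma det_no_zero (k : ℕ) [NeZero k] (f : ZMod k → Fin 3) (h : ∀ v, f v ≠ 0) :
    (1 - chM k f).det = 0 := by
  apply Matrix.exists_mulVec_eq_zero_iff.1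
  refine ⟨fun _ => 1, fun e => one_ne_zero (congrFun e 0), ?_⟩
  funext v
  rw [Matrix.sub_mulVec, Matrix.one_mulVec, Pi.sub_apply, chM_mulVec]
  simp [h]

lemma det_two_cycle (k : ℕ) [NeZero k] (hk : 3 ≤ k) (f : ZMod k → Fin 3) (v : ZMod k)
    (h : f v = 1) (h' : f (v + 1) = 2) : (1 - chM k f).det = 0 := by
  have h1 : (1 : ZMod k) ≠ 0 := by
    have : Fact (1 < k) := ⟨by omega⟩
    exact one_ne_zero
  apply Matrix.exists_vecMul_eq_zero_iff.1
  refine ⟨Pi.single v 1 + Pi.single (v + 1) 1, fun e => ?_, ?_⟩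
  · have := congrFun e v
    simp [h1] at this
  · funext j
    rw [Matrix.add_vecMul]
    simp only [Matrix.single_one_vecMul, Pi.add_apply, Matrix.row, Matrix.sub_apply, chM,
      Matrix.of_apply, h, h', chP, Matrix.one_apply, Pi.single_apply]
    simp [Pi.single_apply, eq_comm]

/-- The walk from `v` dies. -/
def Dies (k : ℕ) [NeZero k] (f : ZMod k → Fin 3) (v : ZMod k) : Prop :=
  ∃ n, ∀ m ≥ n, ∀ x : ZMod k → ℤ, ((chM k f) ^ m).mulVec x v = 0

lemma dies_step (k : ℕ) [NeZero k] (f : ZMod k → Fin 3) (v : ZMod k)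
    (h1 : f v = 1 → Dies k f (v + 1)) (h2 : f v = 2 → Dies k f (v - 1)) : Dies k f v := by
  have key : ∀ m x, ((chM k f) ^ (m + 1)).mulVec x v =
      if f v = 0 then 0 else if f v = 1 then ((chM k f) ^ m).mulVec x (v + 1)
        else ((chM k f) ^ m).mulVec x (v - 1) := by
    intro m x
    rw [pow_succ', ← Matrix.mulVec_mulVec, chM_mulVec]
  have hc : f v = 0 ∨ f v = 1 ∨ f v = 2 := by
    generalize f v = c
    revert c; decide
  rcases hc with h | h | h
  · refine ⟨1, fun m hm x => ?_⟩
    obtain ⟨m, rfl⟩ := Nat.exists_eq_add_of_le' hm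
    rw [key]; simp [h]
  · obtain ⟨n, hn⟩ := h1 h
    refine ⟨n + 1, fun m hm x => ?_⟩
    obtain ⟨m, rfl⟩ := Nat.exists_eq_add_of_le' (show 1 ≤ m by omega)
    rw [key]; simp [h, hn m (by omega)]
  · obtain ⟨n, hn⟩ := h2 h
    refine ⟨n + 1, fun m hm x => ?_⟩
    obtain ⟨m, rfl⟩ := Nat.exists_eq_add_of_le' (show 1 ≤ m by omega)
    rw [key]; simp [h, hn m (by omega)]

lemma dies_up (k : ℕ) [NeZero k] (f : ZMod k → Fin 3)
    (hf : ∀ v, ¬(f v = 1 ∧ f (v + 1) = 2)) (d : ℕ) :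
    ∀ v, f (v + d) = 0 → f v ≠ 2 → Dies k f v := by
  induction d with
  | zero =>
    intro v h _
    simp only [Nat.cast_zero, add_zero] at h
    exact dies_step k f v (by simp [h]) (by simp [h])
  | succ d ih =>
    intro v h h2
    refine dies_step k f v (fun h1 => ih _ ?_ fun e => hf v ⟨h1, e⟩) (fun e => absurd e h2)
    rw [← h]; congr 1; push_cast; ring

lemma dies_down (k : ℕ) [NeZero k] (f : ZMod k → Fin 3)
    (hf : ∀ v, ¬(f v = 1 ∧ f (v + 1) = 2)) (d : ℕ) :
    ∀ v, f (v - d) = 0 → f v ≠ 1 → Dies k f v := by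
  induction d with
  | zero =>
    intro v h _
    simp only [Nat.cast_zero, sub_zero] at h
    exact dies_step k f v (by simp [h]) (by simp [h])
  | succ d ih =>
    intro v h h2
    refine dies_step k f v (fun e => absurd e h2)
      (fun h1 => ih _ ?_ fun e => hf (v - 1) ⟨e, by simpa using h1⟩)
    rw [← h]; congr 1; push_cast; ring

lemma det_acyclic (k : ℕ) [NeZero k] (f : ZMod k → Fin 3) (h0 : ∃ v, f v = 0)
    (hf : ∀ v, ¬(f v = 1 ∧ f (v + 1) = 2)) : (1 - chM k f).det = 1 := by
  obtain ⟨z, hz⟩ := h0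
  have hd : ∀ v, Dies k f v := by
    intro v
    by_cases h : f v = 2
    · refine dies_down k f hf (v - z).val v ?_ (by simp [h])
      simpa using hz
    · refine dies_up k f hf (z - v).val v ?_ h
      simpa using hz
  choose n hn using hd
  have hnil : IsNilpotent (chM k f) := by
    refine ⟨Finset.univ.sup n, ?_⟩
    apply Matrix.mulVec_injective
    funext x v
    rw [hn v _ (Finset.le_sup (Finset.mem_univ v))]
    simp
  have h := (Matrix.isNilpotent_charpoly_sub_pow_of_isNilpotent hnil).eq_zero
  have h' := congrArg (Polynomial.eval 1) h
  simp only [Polynomial.eval_sub, Matrix.eval_charpoly, Polynomial.eval_pow, Polynomial.eval_X,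
    one_pow, Polynomial.eval_zero, map_one] at h'
  linarith

/-- Substituting `N₁ ↦ −t` into `det M_k` yields the spanning-tree polynomial of
the `(q,t)`-wheel graph: `det(M_k)|_{N₁=−t} = 𝒲_k(q,t)`. -/
theorem det_Mcirc_subst_eq_treeSum (q t : ℤ) (k : ℕ) [NeZero k] (hk : 3 ≤ k) :
    (Mcirc q (-t) k).det = wheelTreeSum q t k := by
  classical
  rw [det_expand q t k hk, wheelTreeSum, Finset.sum_filter]
  refine Finset.sum_congr rfl fun f _ => ?_
  rw [← prod_chW]
  split_ifs with h
  · rw [det_acyclic k f h.1 h.2, mul_one]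
  · have : (1 - chM k f).det = 0 := by
      by_cases h0 : ∃ v, f v = 0
      · have h2 : ¬ ∀ v, ¬(f v = 1 ∧ f (v + 1) = 2) := fun h2 => h ⟨h0, h2⟩
        push Not at h2
        obtain ⟨v, h3, h4⟩ := h2
        exact det_two_cycle k hk f v h3 h4
      · exact det_no_zero k f (by simpa using h0)
    rw [this, mul_zero]
end

section
/- The number of critical configurations of the dollar game on W_k(q,t) (equivalently, the order of the critical group K(W_k(q,t))) equals 𝒲_k(q,t) = β₁^k + β₂^k − 1 − q^k evaluated at integers q ≥ 0, t ≥ 1, where β₁, β₂ are the roots of X² − (1+q+t)X + q. In particular |K(W_k(q,t))| = −N_k(q, −t) where N_k is the bivariate point-count polynomial of an elliptic curve. -/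
/-- Firing rim vertex `v` of `W_k(q,t)`. -/
def fire (q t : ℤ) {k : ℕ} [NeZero k] (c : ZMod k → ℤ) (v : ZMod k) : ZMod k → ℤ :=
  fun w => c w - (if w = v then 1 + q + t else 0) + (if w = v + 1 then q else 0) +
    (if w = v - 1 then 1 else 0)

/-- A legal rim-vertex firing step. -/
def FireStep (q t : ℤ) {k : ℕ} [NeZero k] (c c' : ZMod k → ℤ) : Prop :=
  ∃ v, 1 + q + t ≤ c v ∧ c' = fire q t c v

/-- Stability: nonnegative entries, no rim vertex can fire. -/
def Stable (q t : ℤ) {k : ℕ} [NeZero k] (c : ZMod k → ℤ) : Prop :=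
  (∀ v, 0 ≤ c v) ∧ ∀ v, ¬(1 + q + t ≤ c v)

/-- Recurrence: after firing the hub (adding `t` chips to every rim vertex),
some sequence of rim-vertex firings returns to `c`. -/
def Recurrent (q t : ℤ) {k : ℕ} [NeZero k] (c : ZMod k → ℤ) : Prop :=
  Relation.ReflTransGen (FireStep q t) (fun v => c v + t) c

/-- A critical configuration is one that is stable and recurrent. -/
def Critical (q t : ℤ) {k : ℕ} [NeZero k] (c : ZMod k → ℤ) : Prop :=
  Stable q t c ∧ Recurrent q t c

open Matrix

/-- The cyclic shift matrix. -/
def shiftM (R : Type) [CommRing R] (k : ℕ) [NeZero k] : Matrix (ZMod k) (ZMod k) R :=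
  fun i j => if j = i + 1 then 1 else 0

lemma shiftM_mulVec {R : Type} [CommRing R] {k : ℕ} [NeZero k] (x : ZMod k → R) (i : ZMod k) :
    (shiftM R k *ᵥ x) i = x (i + 1) := by
  simp [Matrix.mulVec, dotProduct, shiftM]

lemma shiftM_transpose_mulVec {R : Type} [CommRing R] {k : ℕ} [NeZero k] (x : ZMod k → R)
    (i : ZMod k) : ((shiftM R k)ᵀ *ᵥ x) i = x (i - 1) := by
  have : ∀ j : ZMod k, (i = j + 1) ↔ (j = i - 1) := fun j => by
    constructor
    · rintro rfl; ring
    · rintro rfl; ring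
  simp [Matrix.mulVec, dotProduct, shiftM, this]

lemma shiftM_transpose_mul {R : Type} [CommRing R] {k : ℕ} [NeZero k] :
    (shiftM R k)ᵀ * (shiftM R k) = 1 := by
  ext i j
  have : ∀ x : ZMod k, (i = x + 1) ↔ (x = i - 1) := fun x => by
    constructor
    · rintro rfl; ring
    · rintro rfl; ring
  simp only [Matrix.mul_apply, Matrix.transpose_apply, shiftM, this, ite_mul, one_mul, zero_mul,
    Finset.sum_ite_eq', Finset.sum_ite_eq, Finset.mem_univ, if_true, sub_add_cancel,
    Matrix.one_apply, eq_comm]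

lemma shift_sign {k : ℕ} [NeZero k] :
    Equiv.Perm.sign (Equiv.addRight (1 : ZMod k)) = (-1) ^ (k - 1) := by
  obtain ⟨n, rfl⟩ : ∃ n, k = n + 1 := ⟨k - 1, by have := NeZero.pos k; omega⟩
  have h : (Equiv.addRight (1 : ZMod (n + 1)) : Equiv.Perm (ZMod (n+1)))
      = (finRotate (n + 1) : Equiv.Perm (Fin (n + 1))) := by
    apply Equiv.ext
    intro i
    exact (finRotate_apply (n := n + 1) i).symm
  have h2 := sign_finRotate (n + 1)
  rw [← h2]
  exact congrArg (fun s : Equiv.Perm (Fin (n + 1)) => Equiv.Perm.sign s) h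

lemma det_shift {R : Type} [CommRing R] {k : ℕ} [NeZero k] (hk : 3 ≤ k) (a b : R) :
    (a • (1 : Matrix (ZMod k) (ZMod k) R) - b • shiftM R k).det = a ^ k - b ^ k := by
  have h1 : (1 : ZMod k) ≠ 0 := by
    have : Fact (1 < k) := ⟨by omega⟩
    exact one_ne_zero
  rw [Matrix.det_apply', ← Finset.sum_subset (Finset.subset_univ
    ({1, Equiv.addRight (-1 : ZMod k)} : Finset (Equiv.Perm (ZMod k))))]
  · have hne : (1 : Equiv.Perm (ZMod k)) ≠ Equiv.addRight (-1 : ZMod k) := by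
      intro h
      have := congrArg (fun s : Equiv.Perm (ZMod k) => s 0) h
      simp at this
      exact h1 this
    rw [Finset.sum_pair hne]
    have hs : Equiv.Perm.sign (Equiv.addRight (-1 : ZMod k)) = (-1) ^ (k - 1) := by
      rw [← shift_sign, ← Equiv.Perm.sign_inv]
      congr 1
      ext i; simp [Equiv.Perm.inv_def]
    have e1 : ∀ i : ZMod k, (a • (1 : Matrix (ZMod k) (ZMod k) R) - b • shiftM R k) i i = a := by
      intro i; simp [shiftM, h1]
    have e2 : ∀ i : ZMod k,
        (a • (1 : Matrix (ZMod k) (ZMod k) R) - b • shiftM R k) (i + (-1)) i = -b := by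
      intro i; simp [shiftM, h1, Matrix.one_apply]
    simp only [Equiv.Perm.coe_one, id, e1, Equiv.coe_addRight, e2, hs]
    simp only [Finset.prod_const, Finset.card_univ, ZMod.card]
    obtain ⟨n, rfl⟩ : ∃ n, k = n + 1 := ⟨k - 1, by omega⟩
    simp
    rw [neg_pow b, pow_succ (-1 : R) n, ← mul_assoc, ← mul_assoc, ← pow_add]
    rw [Even.neg_one_pow ⟨n, rfl⟩]
    ring
  · intro s _ hs
    by_contra hne
    apply hs
    have hent : ∀ i, s i = i ∨ s i = i - 1 := by
      intro i
      by_contra hcon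
      push Not at hcon
      apply hne
      rw [Finset.prod_eq_zero (Finset.mem_univ i), mul_zero]
      have : ¬ (i = s i + 1) := fun h => hcon.2 (by rw [eq_sub_iff_add_eq]; exact h.symm)
      simp [shiftM, Matrix.one_apply, hcon.1, this]
    simp only [Finset.mem_insert, Finset.mem_singleton]
    by_cases hall : ∀ i, s i = i
    · left; ext i; simp [hall]
    · right
      push Not at hall
      obtain ⟨i, hi⟩ := hall
      have key : ∀ n : ℕ, s (i - n) = i - n - 1 := by
        intro n
        induction n with
        | zero => simpa using (hent i).resolve_left hi
        | succ n ih =>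
          refine (hent _).resolve_left ?_
          intro h
          have h2 : s (i - (n + 1 : ℕ)) = s (i - n) := by
            rw [h, ih]; push_cast; ring
          have h3 := s.injective h2
          push_cast at h3
          apply h1
          linear_combination -h3
      apply Equiv.ext
      intro j
      have h4 := key (i - j).val
      rw [ZMod.natCast_zmod_val] at h4
      simp only [sub_sub_cancel] at h4
      rw [h4]; simp [sub_eq_add_neg]

/-- The reduced Laplacian. -/
def lapM (R : Type) [CommRing R] (q t : R) (k : ℕ) [NeZero k] : Matrix (ZMod k) (ZMod k) R :=
  (1 + q + t) • 1 - q • (shiftM R k)ᵀ - shiftM R k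

lemma lapM_mulVec {R : Type} [CommRing R] {k : ℕ} [NeZero k] (q t : R) (x : ZMod k → R)
    (i : ZMod k) : (lapM R q t k *ᵥ x) i = (1 + q + t) * x i - q * x (i - 1) - x (i + 1) := by
  simp [lapM, Matrix.sub_mulVec, Matrix.smul_mulVec, shiftM_mulVec, shiftM_transpose_mulVec]

lemma lapM_det {k : ℕ} [NeZero k] (hk : 3 ≤ k) (q t : ℤ) (β₁ β₂ : ℝ)
    (hsum : β₁ + β₂ = 1 + (q : ℝ) + (t : ℝ)) (hprod : β₁ * β₂ = (q : ℝ)) :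
    (((lapM ℤ q t k).det : ℤ) : ℝ) = β₁ ^ k + β₂ ^ k - 1 - (q : ℝ) ^ k := by
  have hmap : (lapM ℤ q t k).map (Int.castRingHom ℝ) = lapM ℝ q t k := by
    ext i j
    simp only [lapM, shiftM, Matrix.map_apply, Matrix.sub_apply, Matrix.smul_apply,
      Matrix.one_apply, Matrix.transpose_apply]
    simp only [smul_eq_mul, map_sub, map_mul, map_add, map_one, eq_intCast]
    push_cast
    simp
  have hd : (((lapM ℤ q t k).det : ℤ) : ℝ) = (lapM ℝ q t k).det := by
    rw [← hmap]
    exact (Int.castRingHom ℝ).map_det _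
  have hfac : lapM ℝ q t k = ((1 : ℝ) • (1 : Matrix (ZMod k) (ZMod k) ℝ) - β₁ • shiftM ℝ k)ᵀ *
      (β₂ • (1 : Matrix (ZMod k) (ZMod k) ℝ) - (1 : ℝ) • shiftM ℝ k) := by
    rw [lapM, ← hsum, ← hprod]
    simp only [ one_smul, Matrix.transpose_sub, Matrix.transpose_one,
      Matrix.transpose_smul, sub_mul, mul_sub, one_mul, mul_one, Matrix.smul_mul, Matrix.mul_smul,
      shiftM_transpose_mul]
    module
  rw [hd, hfac, Matrix.det_mul, Matrix.det_transpose, det_shift hk, det_shift hk, ← hprod]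
  ring

/-- The Laplacian acting on functions. -/
def lapF (q t : ℤ) {k : ℕ} [NeZero k] (x : ZMod k → ℤ) : ZMod k → ℤ :=
  fun i => (1 + q + t) * x i - q * x (i - 1) - x (i + 1)

/-- Dhar's burning condition. -/
def Burn (q t : ℤ) {k : ℕ} [NeZero k] (c : ZMod k → ℤ) : Prop :=
  ∀ S : Finset (ZMod k), S.Nonempty → ∃ v ∈ S,
    1 + q + t ≤ c v + t + (if v - 1 ∈ S then 0 else q) + (if v + 1 ∈ S then 0 else 1)

lemma exists_max {k : ℕ} [NeZero k] (x : ZMod k → ℤ) : ∃ v, ∀ w, x w ≤ x v := by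
  obtain ⟨v, -, hv⟩ := Finset.exists_max_image Finset.univ x ⟨0, Finset.mem_univ _⟩
  exact ⟨v, fun w => hv w (Finset.mem_univ _)⟩

lemma lapF_max {q t : ℤ} (hq : 0 ≤ q) {k : ℕ} [NeZero k] (x : ZMod k → ℤ)
    (v : ZMod k) (hv : ∀ w, x w ≤ x v) : t * x v ≤ lapF q t x v := by
  have h1 := mul_le_mul_of_nonneg_left (hv (v - 1)) hq
  have h2 := hv (v + 1)
  simp only [lapF]
  nlinarith

lemma lapF_sub (q t : ℤ) {k : ℕ} [NeZero k] (x y : ZMod k → ℤ) :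
    lapF q t (x - y) = lapF q t x - lapF q t y := by
  ext i; simp only [lapF, Pi.sub_apply]; ring

lemma lapF_add (q t : ℤ) {k : ℕ} [NeZero k] (x y : ZMod k → ℤ) :
    lapF q t (x + y) = lapF q t x + lapF q t y := by
  ext i; simp only [lapF, Pi.add_apply]; ring

lemma lapF_nonpos {q t : ℤ} (hq : 0 ≤ q) (ht : 1 ≤ t) {k : ℕ} [NeZero k] (x : ZMod k → ℤ)
    (h : lapF q t x = 0) (w : ZMod k) : x w ≤ 0 := by
  obtain ⟨v, hv⟩ := exists_max x
  have h1 := lapF_max (t := t) hq x v hv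
  rw [h] at h1
  have h2 := hv w
  simp only [Pi.zero_apply] at h1
  nlinarith

lemma lapF_inj {q t : ℤ} (hq : 0 ≤ q) (ht : 1 ≤ t) {k : ℕ} [NeZero k] {x y : ZMod k → ℤ}
    (h : lapF q t x = lapF q t y) : x = y := by
  have h1 := lapF_nonpos hq ht (x - y) (by rw [lapF_sub, h, sub_self])
  have h2 := lapF_nonpos hq ht (y - x) (by rw [lapF_sub, h, sub_self])
  ext w
  have := h1 w
  have := h2 w
  simp only [Pi.sub_apply] at *
  omega

lemma fire_eq (q t : ℤ) {k : ℕ} [NeZero k] (c : ZMod k → ℤ) (v : ZMod k) :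
    fire q t c v = c - lapF q t (Pi.single v 1) := by
  ext w
  have e1 : (w - 1 = v) ↔ (w = v + 1) := sub_eq_iff_eq_add
  have e2 : (w + 1 = v) ↔ (w = v - 1) := eq_sub_iff_add_eq.symm
  simp only [fire, lapF, Pi.sub_apply, Pi.single_apply, e1, e2]
  split_ifs <;> ring

lemma path_script {q t : ℤ} {k : ℕ} [NeZero k] {a b : ZMod k → ℤ}
    (h : Relation.ReflTransGen (FireStep q t) a b) :
    ∃ x : ZMod k → ℤ, 0 ≤ x ∧ b = a - lapF q t x ∧
      ∀ S : Finset (ZMod k), (∃ v ∈ S, 0 < x v) → ∃ v ∈ S, ∃ y : ZMod k → ℤ,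
        y ≤ x ∧ (∀ w ∈ S, y w = 0) ∧ 1 + q + t ≤ a v - lapF q t y v := by
  induction h with
  | refl =>
    refine ⟨0, le_rfl, ?_, ?_⟩
    · ext i; simp [lapF]
    · rintro S ⟨v, _, hv⟩; simp at hv
  | tail _ hstep ih =>
    obtain ⟨x, hx0, rfl, hS⟩ := ih
    obtain ⟨v, hv, rfl⟩ := hstep
    have hxle : x ≤ x + Pi.single v 1 := by
      intro w; simp only [Pi.add_apply, Pi.single_apply]; split_ifs <;> omega
    refine ⟨x + Pi.single v 1, hx0.trans hxle, ?_, ?_⟩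
    · rw [fire_eq, lapF_add, sub_sub]
    · rintro S ⟨u, huS, hu⟩
      by_cases hx : ∃ w ∈ S, 0 < x w
      · obtain ⟨w, hw, y, hy, h1, h2⟩ := hS S hx
        exact ⟨w, hw, y, hy.trans hxle, h1, h2⟩
      · push Not at hx
        have hz : ∀ w ∈ S, x w = 0 := fun w hw => le_antisymm (hx w hw) (hx0 w)
        have huv : u = v := by
          by_contra hne
          simp [Pi.single_apply, hne, hz u huS] at hu
        subst huv
        exact ⟨u, huS, x, hxle, hz, hv⟩

lemma lapF_one (q t : ℤ) {k : ℕ} [NeZero k] : lapF q t (fun _ : ZMod k => 1) = fun _ => t := by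
  ext i; simp only [lapF]; ring

lemma burn_of_recurrent {q t : ℤ} (hq : 0 ≤ q) (ht : 1 ≤ t) {k : ℕ} [NeZero k]
    {c : ZMod k → ℤ} (h : Recurrent q t c) : Burn q t c := by
  obtain ⟨x, hx0, hx, hS⟩ := path_script h
  have hx1 : x = fun _ => 1 := by
    apply lapF_inj hq ht
    rw [lapF_one]
    ext i
    have := congrFun hx i
    simp only [Pi.sub_apply] at this
    omega
  subst hx1
  rintro S ⟨u, hu⟩
  obtain ⟨v, hv, y, hy, hy0, hle⟩ := hS S ⟨u, hu, one_pos⟩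
  refine ⟨v, hv, hle.trans ?_⟩
  simp only [lapF, hy0 v hv]
  have h1 : q * y (v - 1) ≤ if v - 1 ∈ S then 0 else q := by
    split_ifs with h
    · simp [hy0 _ h]
    · have := hy (v - 1)
      simp only at this
      nlinarith
  have h2 : y (v + 1) ≤ if v + 1 ∈ S then 0 else 1 := by
    split_ifs with h
    · simp [hy0 _ h]
    · exact hy (v + 1)
  linarith

/-- Indicator of a finset. -/
def ind {k : ℕ} (S : Finset (ZMod k)) : ZMod k → ℤ := fun v => if v ∈ S then 1 else 0

lemma recurrent_of_burn {q t : ℤ} {k : ℕ} [NeZero k]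
    {c : ZMod k → ℤ} (h : Burn q t c) : Recurrent q t c := by
  have key : ∀ n : ℕ, ∀ S : Finset (ZMod k), S.card = n →
      Relation.ReflTransGen (FireStep q t) (c + lapF q t (ind S)) c := by
    intro n
    induction n with
    | zero =>
      intro S hS
      rw [Finset.card_eq_zero] at hS
      subst hS
      have : c + lapF q t (ind ∅) = c := by ext i; simp [lapF, ind]
      rw [this]
    | succ n ih =>
      intro S hS
      obtain ⟨v, hv, hle⟩ := h S (Finset.card_pos.mp (by omega))
      refine Relation.ReflTransGen.head ⟨v, ?_, rfl⟩ ?_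
      · refine hle.trans ?_
        simp only [Pi.add_apply, lapF, ind, hv, if_true]
        split_ifs <;> linarith
      · have e : fire q t (c + lapF q t (ind S)) v = c + lapF q t (ind (S.erase v)) := by
          have : ind S = ind (S.erase v) + Pi.single v 1 := by
            ext w
            simp only [ind, Finset.mem_erase, Pi.add_apply, Pi.single_apply]
            by_cases hw : w = v
            · subst hw; simp [hv]
            · simp [hw]
          rw [fire_eq, this, lapF_add]
          abel
        rw [e]
        apply ih
        rw [Finset.card_erase_of_mem hv, hS]; rfl
  have := key _ Finset.univ rfl
  have e : c + lapF q t (ind Finset.univ) = fun v => c v + t := by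
    have : ind (Finset.univ : Finset (ZMod k)) = fun _ => 1 := by ext; simp [ind]
    rw [this, lapF_one]; rfl
  rwa [e] at this

lemma critical_iff {q t : ℤ} (hq : 0 ≤ q) (ht : 1 ≤ t) {k : ℕ} [NeZero k]
    (c : ZMod k → ℤ) : Critical q t c ↔ (∀ v, c v < 1 + q + t) ∧ Burn q t c := by
  constructor
  · rintro ⟨hs, hr⟩
    exact ⟨fun v => not_le.mp (hs.2 v), burn_of_recurrent hq ht hr⟩
  · rintro ⟨hs, hb⟩
    refine ⟨⟨fun v => ?_, fun v => not_le.mpr (hs v)⟩, recurrent_of_burn hb⟩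
    obtain ⟨w, hw, hle⟩ := hb {v} (Finset.singleton_nonempty v)
    rw [Finset.mem_singleton] at hw
    subst hw
    split_ifs at hle <;> linarith

lemma unique_aux {q t : ℤ} (hq : 0 ≤ q) (ht : 1 ≤ t) {k : ℕ} [NeZero k]
    {c d n : ZMod k → ℤ} (hc : ∀ v, c v < 1 + q + t) (hd : Burn q t d)
    (h : c = d + lapF q t n) (w : ZMod k) : n w ≤ 0 := by
  obtain ⟨m, hm⟩ := exists_max n
  by_contra hw
  push Not at hw
  have hpos : 1 ≤ n m := by have := hm w; omega
  obtain ⟨v, hv, hle⟩ := hd (Finset.univ.filter fun v => n v = n m) ⟨m, by simp⟩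
  simp only [Finset.mem_filter, Finset.mem_univ, true_and] at hv hle
  have hcv := hc v
  rw [h] at hcv
  simp only [Pi.add_apply, lapF, hv] at hcv
  have h1 : (if n (v - 1) = n m then 0 else q) ≤ q * (n m - n (v - 1)) := by
    split_ifs with h
    · simp [h]
    · have : n (v - 1) < n m := lt_of_le_of_ne (hm _) h
      nlinarith
  have h2 : (if n (v + 1) = n m then 0 else 1) ≤ (n m - n (v + 1)) := by
    split_ifs with h
    · simp [h]
    · have : n (v + 1) < n m := lt_of_le_of_ne (hm _) h
      omega
  nlinarith

lemma exists_critical {q t : ℤ} (hq : 0 ≤ q) (ht : 1 ≤ t) {k : ℕ} [NeZero k]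
    (a : ZMod k → ℤ) : ∃ n, Critical q t (a + lapF q t n) := by
  let P : ℤ → Prop := fun s => ∃ n : ZMod k → ℤ,
    (∀ v, (a + lapF q t n) v < 1 + q + t) ∧ ∑ v, n v = s
  obtain ⟨ma, hma⟩ := exists_max a
  obtain ⟨mb, hmb⟩ := exists_max (-a)
  have hne : ∃ s, P s := by
    refine ⟨_, fun _ => -|a ma|, fun v => ?_, rfl⟩
    have h1 := hma v
    have h2 := le_abs_self (a ma)
    have h3 := abs_nonneg (a ma)
    simp only [Pi.add_apply, lapF]
    nlinarith
  have hbd : ∃ b, ∀ s, P s → s ≤ b := by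
    refine ⟨∑ _v : ZMod k, (1 + q + t + |a mb|), ?_⟩
    rintro s ⟨n, hn, rfl⟩
    apply Finset.sum_le_sum
    intro v _
    obtain ⟨m, hm⟩ := exists_max n
    refine (hm v).trans ?_
    have h1 := lapF_max (t := t) hq n m hm
    have h2 := hn m
    have h3 := hmb m
    have h4 := neg_le_abs (a mb)
    have h5 := abs_nonneg (a mb)
    simp only [Pi.add_apply, Pi.neg_apply] at h2 h3
    by_contra hcon
    push Not at hcon
    nlinarith
  obtain ⟨s, ⟨n, hn, hs⟩, hmax⟩ := Int.exists_greatest_of_bdd hbd hne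
  refine ⟨n, (critical_iff hq ht _).mpr ⟨hn, ?_⟩⟩
  intro S hS
  by_contra hcon
  push Not at hcon
  have hP : P (∑ v, (n + ind S) v) := by
    refine ⟨n + ind S, fun v => ?_, rfl⟩
    rw [lapF_add, ← add_assoc, Pi.add_apply]
    by_cases hv : v ∈ S
    · have := hcon v hv
      refine lt_of_le_of_lt ?_ this
      rw [show lapF q t (ind S) v = (1 + q + t) * 1 - q * (if v - 1 ∈ S then 1 else 0)
        - (if v + 1 ∈ S then 1 else 0) by simp [lapF, ind, hv]]
      split_ifs <;> linarith
    · refine lt_of_le_of_lt ?_ (hn v)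
      rw [show lapF q t (ind S) v = (1 + q + t) * 0 - q * (if v - 1 ∈ S then 1 else 0)
        - (if v + 1 ∈ S then 1 else 0) by simp [lapF, ind, hv]]
      split_ifs <;> linarith
  have := hmax _ hP
  simp only [Pi.add_apply, Finset.sum_add_distrib, hs] at this
  have hc : ∑ v, ind S v = S.card := by simp [ind]
  have := Finset.card_pos.mpr hS
  omega

lemma card_critical {q t : ℤ} (hq : 0 ≤ q) (ht : 1 ≤ t) {k : ℕ} [NeZero k] :
    {c : ZMod k → ℤ | Critical q t c}.ncard = (lapM ℤ q t k).det.natAbs := by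
  have hlap : ∀ x, Matrix.toLin' (lapM ℤ q t k) x = lapF q t x := by
    intro x; ext i; rw [Matrix.toLin'_apply, lapM_mulVec]; rfl
  have hinj : Function.Injective (Matrix.toLin' (lapM ℤ q t k)) := by
    intro x y hxy
    rw [hlap, hlap] at hxy
    exact lapF_inj hq ht hxy
  have hdet := Submodule.natAbs_det_equiv (LinearMap.range (Matrix.toLin' (lapM ℤ q t k)))
    (LinearEquiv.ofInjective _ hinj)
  have hdet2 : (LinearMap.det (Matrix.toLin' (lapM ℤ q t k))).natAbs =
      Nat.card ((ZMod k → ℤ) ⧸ LinearMap.range (Matrix.toLin' (lapM ℤ q t k))) := by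
    rw [← hdet]
    rfl
  rw [LinearMap.det_toLin'] at hdet2
  rw [hdet2, ← Nat.card_coe_set_eq]
  apply Nat.card_eq_of_bijective
    (fun c : {c : ZMod k → ℤ | Critical q t c} => Submodule.Quotient.mk c.1)
  constructor
  · rintro ⟨c, hc⟩ ⟨d, hd⟩ h
    rw [Submodule.Quotient.eq] at h
    obtain ⟨n, hn⟩ := h
    rw [hlap] at hn
    have hc' := (critical_iff hq ht _).mp hc
    have hd' := (critical_iff hq ht _).mp hd
    have h1 := unique_aux hq ht hc'.1 hd'.2 (n := n) (by rw [hn]; simp)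
    have h2 := unique_aux hq ht hd'.1 hc'.2 (n := 0 - n) (by
      rw [lapF_sub, hn]; ext; simp [lapF])
    have : n = 0 := by
      ext w; have := h1 w; have := h2 w; simp only [Pi.sub_apply, Pi.zero_apply] at *; omega
    subst this
    apply Subtype.ext
    ext w
    have := congrFun hn w
    simp [lapF] at this
    simp only; omega
  · intro a
    obtain ⟨a, rfl⟩ := Submodule.Quotient.mk_surjective _ a
    obtain ⟨n, hn⟩ := exists_critical hq ht a
    refine ⟨⟨_, hn⟩, ?_⟩
    rw [Submodule.Quotient.eq]
    exact ⟨n, by rw [hlap]; simp⟩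

lemma powerSum_nonneg {q t : ℤ} (hq : 0 ≤ q) (ht : 1 ≤ t)
    (k : ℕ) (β₁ β₂ : ℝ)
    (hsum : β₁ + β₂ = 1 + (q : ℝ) + (t : ℝ)) (hprod : β₁ * β₂ = (q : ℝ)) :
    0 ≤ β₁ ^ k + β₂ ^ k - 1 - (q : ℝ) ^ k := by
  have hq' : (0 : ℝ) ≤ q := by exact_mod_cast hq
  have ht' : (1 : ℝ) ≤ t := by exact_mod_cast ht
  wlog hle : β₁ ≤ β₂ generalizing β₁ β₂
  · have := this β₂ β₁ (by linarith) (by linarith) (by linarith)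
    linarith
  have hb2 : 0 < β₂ := by linarith
  have hb1 : 0 ≤ β₁ := by
    by_contra h
    push Not at h
    nlinarith
  have h1 : β₁ ≤ 1 := by by_contra h; nlinarith
  have h2 : 1 ≤ β₂ := by by_contra h; nlinarith
  have e1 := pow_le_one₀ (n := k) hb1 h1
  have e2 := one_le_pow₀ (n := k) h2
  rw [← hprod, mul_pow]
  nlinarith

/-- The number of critical configurations of the dollar game on `W_k(q,t)`
(the order of the critical group `K(W_k(q,t))`) equals
`𝒲_k(q,t) = β₁^k + β₂^k − 1 − q^k`, where `β₁, β₂` are the (real) roots of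
`X² − (1+q+t)X + q`.  Equivalently `|K(W_k(q,t))| = −N_k(q,−t)`, where
`N_k(q,N₁) = 1 + q^k − α₁^k − α₂^k` is the bivariate point-count polynomial
of an elliptic curve. -/
theorem card_critical_eq_powerSum (q t : ℤ) (hq : 0 ≤ q) (ht : 1 ≤ t)
    (k : ℕ) [NeZero k] (hk : 3 ≤ k) (β₁ β₂ : ℝ)
    (hsum : β₁ + β₂ = 1 + (q : ℝ) + (t : ℝ)) (hprod : β₁ * β₂ = (q : ℝ)) :
    (({c : ZMod k → ℤ | Critical q t c}.ncard : ℝ)) =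
      β₁ ^ k + β₂ ^ k - 1 - (q : ℝ) ^ k := by
  rw [card_critical hq ht, ← lapM_det hk q t β₁ β₂ hsum hprod, Nat.cast_natAbs, Int.cast_abs,
    abs_of_nonneg]
  rw [lapM_det hk q t β₁ β₂ hsum hprod]
  exact powerSum_nonneg hq ht k β₁ β₂ hsum hprod
end
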